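/- Let j and k be integers with j ≥ k ≥ 1. Then the graph H(j,k) satisfies gpg(H(j,k)) = j + k + 1 and gpg'(H(j,k)) = j + 2. In particular, the pair (j+k+1, j+2) is realisable as (gpg(G), gpg'(G)) for some graph G. -/

import Mathlib

open Finset SimpleGraph

variable {V : Type*}

/-- `S` is in general position in `G`: no shortest path of `G` contains more than
two vertices of `S`. -/
def IsGPSet (G : SimpleGraph V) (S : Set V) : Prop :=
  ∀ ⦃u v : V⦄ (p : G.Walk u v), p.IsPath → p.length = G.dist u v →
    (S ∩ {x | x ∈ p.support}).ncard ≤ 2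

open scoped Classical in
/-- The set of vertices that can legally be played when the set of already selected
vertices is `S`. -/
noncomputable def playable [Fintype V] (G : SimpleGraph V) (S : Finset V) : Finset V :=
  Finset.univ.filter (fun v => v ∉ S ∧ IsGPSet G (↑(insert v S) : Set V))

open scoped Classical in
/-- Value (final set size with optimal play) of the Builder-Blocker general position game
from position `S` with the given player to move (`true` = Builder, the maximiser;
`false` = Blocker, the minimiser), computed with a fuel parameter. -/
noncomputable def gameValAux [Fintype V] (G : SimpleGraph V) : ℕ → Bool → Finset V → ℕ
  | 0, _, S => S.card
  | fuel + 1, turn, S =>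
    if h : (playable G S).Nonempty then
      if turn then (playable G S).sup' h (fun v => gameValAux G fuel (!turn) (insert v S))
      else (playable G S).inf' h (fun v => gameValAux G fuel (!turn) (insert v S))
    else S.card

/-- Value of the Builder-Blocker general position game from position `S`,
with `turn = true` meaning Builder (the maximiser) is to move. Since at most
`Fintype.card V - S.card` further moves are possible, this fuel suffices. -/
noncomputable def gameVal [Fintype V] (G : SimpleGraph V) (turn : Bool) (S : Finset V) : ℕ :=
  gameValAux G (Fintype.card V - S.card) turn S

/-- The B-game general position number: Builder moves first. -/
noncomputable def gpg [Fintype V] (G : SimpleGraph V) : ℕ := gameVal G true ∅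

/-- The B'-game general position number: Blocker moves first. -/
noncomputable def gpg' [Fintype V] (G : SimpleGraph V) : ℕ := gameVal G false ∅

/-- Predicate: a clique vertex lies in `J₁ ∪ J₂` (the vertices joined to `z`). -/
def inJPart {j k : ℕ} : (Fin j ⊕ Fin j) ⊕ (Fin k ⊕ Fin k) → Prop
  | Sum.inl _ => True
  | _ => False

/-- Predicate: a clique vertex lies in `J₁ ∪ K₁` (the vertices joined to `x₁`). -/
def inSide1 {j k : ℕ} : (Fin j ⊕ Fin j) ⊕ (Fin k ⊕ Fin k) → Prop
  | Sum.inl (Sum.inl _) => True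
  | Sum.inr (Sum.inl _) => True
  | _ => False

/-- Predicate: a clique vertex lies in `J₂ ∪ K₂` (the vertices joined to `x₂`). -/
def inSide2 {j k : ℕ} : (Fin j ⊕ Fin j) ⊕ (Fin k ⊕ Fin k) → Prop
  | Sum.inl (Sum.inr _) => True
  | Sum.inr (Sum.inr _) => True
  | _ => False

/-- Base relation for `H(j,k)`: a clique on `J₁ ∪ J₂ ∪ K₁ ∪ K₂` (with
`|J₁| = |J₂| = j`, `|K₁| = |K₂| = k`), plus `z` (encoded `Sum.inr 0`) joined to
`J₁ ∪ J₂`, `x₁` (encoded `Sum.inr 1`) joined to `J₁ ∪ K₁`, and `x₂` (encoded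
`Sum.inr 2`) joined to `J₂ ∪ K₂`. -/
def HjkRel (j k : ℕ) :
    ((Fin j ⊕ Fin j) ⊕ (Fin k ⊕ Fin k)) ⊕ Fin 3 →
    ((Fin j ⊕ Fin j) ⊕ (Fin k ⊕ Fin k)) ⊕ Fin 3 → Prop
  | Sum.inl _, Sum.inl _ => True
  | Sum.inr e, Sum.inl c => (e = 0 ∧ inJPart c) ∨ (e = 1 ∧ inSide1 c) ∨ (e = 2 ∧ inSide2 c)
  | _, _ => False

/-- The graph `H(j,k)`. -/
def Hjk (j k : ℕ) : SimpleGraph (((Fin j ⊕ Fin j) ⊕ (Fin k ⊕ Fin k)) ⊕ Fin 3) :=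
  SimpleGraph.fromRel (HjkRel j k)

section Geodesics

variable {G : SimpleGraph V}

theorem dist_getVert_of_length_eq_dist (hG : G.Connected) {u v : V} (p : G.Walk u v)
    (hp : p.length = G.dist u v) {a b : ℕ} (hab : a ≤ b) (hb : b ≤ p.length) :
    G.dist (p.getVert a) (p.getVert b) = b - a := by
  have h₁ := dist_le (p.take a)
  have h₂ := dist_le ((p.drop a).take (b - a))
  have h₃ := dist_le (p.drop b)
  have h₄ := hG.dist_triangle (u := u) (v := p.getVert a) (w := v)
  have h₅ := hG.dist_triangle (u := p.getVert a) (v := p.getVert b) (w := v)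
  simp only [Walk.take_length, Walk.drop_length, Walk.drop_getVert,
    Nat.add_sub_cancel' hab] at h₁ h₂ h₃
  omega

/-- In a connected graph, general position means that no selected vertex lies between
two others. -/
theorem isGPSet_iff_dist (hG : G.Connected) (S : Set V) :
    IsGPSet G S ↔ ∀ a ∈ S, ∀ b ∈ S, ∀ c ∈ S, a ≠ b → a ≠ c → b ≠ c →
      G.dist a b + G.dist b c ≠ G.dist a c := by
  constructor
  · intro h a ha b hb c hc hab hac hbc hd
    obtain ⟨p, hp⟩ := hG.exists_walk_length_eq_dist a b
    obtain ⟨q, hq⟩ := hG.exists_walk_length_eq_dist b c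
    have hpq : (p.append q).length = G.dist a c := by rw [Walk.length_append, hp, hq, hd]
    have hle := h _ (Walk.isPath_of_length_eq_dist _ hpq) hpq
    refine absurd hle (not_le.mpr ?_)
    refine (Set.two_lt_ncard_iff
      (((p.append q).support.finite_toSet).subset Set.inter_subset_right)).mpr
      ⟨a, b, c, ⟨ha, ?_⟩, ⟨hb, ?_⟩, ⟨hc, ?_⟩, hab, hac, hbc⟩ <;> simp
  · intro h u v p _ hp
    by_contra! hlt
    obtain ⟨a, b, c, ⟨ha, hap⟩, ⟨hb, hbp⟩, ⟨hc, hcp⟩, hab, hac, hbc⟩ :=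
      (Set.two_lt_ncard_iff (p.support.finite_toSet.subset Set.inter_subset_right)).mp hlt
    obtain ⟨l, rfl, hl⟩ := Walk.mem_support_iff_exists_getVert.mp hap
    obtain ⟨m, rfl, hm⟩ := Walk.mem_support_iff_exists_getVert.mp hbp
    obtain ⟨n, rfl, hn⟩ := Walk.mem_support_iff_exists_getVert.mp hcp
    have key : ∀ l m n, l ≤ m → m ≤ n → n ≤ p.length →
        G.dist (p.getVert l) (p.getVert m) + G.dist (p.getVert m) (p.getVert n)
          = G.dist (p.getVert l) (p.getVert n) := by
      intro l m n h₁ h₂ h₃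
      rw [dist_getVert_of_length_eq_dist hG p hp h₁ (by omega),
        dist_getVert_of_length_eq_dist hG p hp h₂ h₃,
        dist_getVert_of_length_eq_dist hG p hp (h₁.trans h₂) h₃]
      omega
    rcases le_total l m with h₁ | h₁ <;> rcases le_total m n with h₂ | h₂ <;>
      rcases le_total l n with h₃ | h₃
    · exact h _ ha _ hb _ hc hab hac hbc (key _ _ _ h₁ h₂ hn)
    · exact h _ ha _ hb _ hc hab hac hbc (key _ _ _ h₁ h₂ hn)
    · exact h _ ha _ hc _ hb hac hab hbc.symm (key _ _ _ h₃ h₂ hm)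
    · exact h _ hc _ ha _ hb hac.symm hbc.symm hab (key _ _ _ h₃ h₁ hm)
    · exact h _ hb _ ha _ hc hab.symm hbc hac (key _ _ _ h₁ h₃ hn)
    · exact h _ hb _ hc _ ha hbc hab.symm hac.symm (key _ _ _ h₂ h₃ hl)
    · exact h _ hc _ hb _ ha hbc.symm hac.symm hab.symm (key _ _ _ h₂ h₁ hl)
    · exact h _ hc _ hb _ ha hbc.symm hac.symm hab.symm (key _ _ _ h₂ h₁ hl)

end Geodesics

section Game

theorem isGPSet_of_ncard_le_two (G : SimpleGraph V) {S : Set V} (hS : S.Finite)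
    (h : S.ncard ≤ 2) : IsGPSet G S :=
  fun _ _ _ _ _ => (Set.ncard_le_ncard Set.inter_subset_left hS).trans h

/-- The possible final positions of the game. -/
def IsMaximalGPSet (G : SimpleGraph V) (S : Set V) : Prop :=
  IsGPSet G S ∧ ∀ v ∉ S, ¬ IsGPSet G (insert v S)

variable [Fintype V] {G : SimpleGraph V} {S : Finset V} {m : ℕ}

theorem mem_playable {v : V} :
    v ∈ playable G S ↔ v ∉ S ∧ IsGPSet G (insert v (S : Set V)) := by
  simp [playable]

theorem isMaximalGPSet_of_playable_empty (hS : IsGPSet G S)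
    (h : ¬ (playable G S).Nonempty) : IsMaximalGPSet G (S : Set V) :=
  ⟨hS, fun v hv hv' => h ⟨v, mem_playable.mpr ⟨by simpa using hv, hv'⟩⟩⟩

open scoped Classical in
theorem gameVal_of_nonempty (turn : Bool) (h : (playable G S).Nonempty) :
    gameVal G turn S =
      if turn then (playable G S).sup' h (fun v => gameVal G (!turn) (insert v S))
      else (playable G S).inf' h (fun v => gameVal G (!turn) (insert v S)) := by
  have hfuel : ∀ v ∈ playable G S,
      Fintype.card V - #S = (Fintype.card V - #(insert v S)) + 1 := by
    intro v hv
    have h₁ := card_insert_of_notMem (mem_playable.mp hv).1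
    have h₂ := card_le_univ (insert v S)
    omega
  obtain ⟨w, hw⟩ := h
  have key : ∀ v ∈ playable G S, gameValAux G (Fintype.card V - #(insert w S)) (!turn) (insert v S)
      = gameVal G (!turn) (insert v S) := by
    intro v hv
    rw [gameVal, Nat.add_right_cancel ((hfuel w hw).symm.trans (hfuel v hv))]
  rw [gameVal, hfuel w hw, gameValAux, dif_pos ⟨w, hw⟩]
  congr 1
  · exact sup'_congr _ rfl key
  · exact inf'_congr _ rfl key

theorem gameVal_of_not_nonempty (turn : Bool) (h : ¬ (playable G S).Nonempty) :
    gameVal G turn S = #S := by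
  unfold gameVal
  cases Fintype.card V - #S <;> simp [gameValAux, h]

open scoped Classical in
theorem le_gameVal_true {v : V} (hv : v ∈ playable G S)
    (h : m ≤ gameVal G false (insert v S)) : m ≤ gameVal G true S := by
  rw [gameVal_of_nonempty true ⟨v, hv⟩]
  exact h.trans (le_sup' (fun v => gameVal G (!true) (insert v S)) hv)

open scoped Classical in
theorem gameVal_false_le {v : V} (hv : v ∈ playable G S)
    (h : gameVal G true (insert v S) ≤ m) : gameVal G false S ≤ m := by
  rw [gameVal_of_nonempty false ⟨v, hv⟩]
  exact (inf'_le (fun v => gameVal G (!false) (insert v S)) hv).trans h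

open scoped Classical in
theorem le_gameVal_false (hS : (playable G S).Nonempty)
    (h : ∀ v ∈ playable G S, m ≤ gameVal G true (insert v S)) : m ≤ gameVal G false S := by
  rw [gameVal_of_nonempty false hS]
  exact le_inf' hS _ h

open scoped Classical in
theorem gameVal_true_le (hS : (playable G S).Nonempty)
    (h : ∀ v ∈ playable G S, gameVal G false (insert v S) ≤ m) : gameVal G true S ≤ m := by
  rw [gameVal_of_nonempty true hS]
  exact sup'_le hS _ h

/-- The value of the game is the size of a maximal general position set extending the
current position. -/
theorem exists_card_eq_gameVal (turn : Bool) (hS : IsGPSet G S) :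
    ∃ T : Finset V, S ⊆ T ∧ IsMaximalGPSet G (T : Set V) ∧ #T = gameVal G turn S := by
  classical
  induction hn : Fintype.card V - #S using Nat.strong_induction_on generalizing turn S with
  | _ n ih =>
    by_cases h : (playable G S).Nonempty
    · obtain ⟨v, hv, hval⟩ : ∃ v ∈ playable G S,
          gameVal G turn S = gameVal G (!turn) (insert v S) := by
        rw [gameVal_of_nonempty turn h]
        cases turn
        · obtain ⟨v, hv, he⟩ := exists_mem_eq_inf' h (fun v => gameVal G (!false) (insert v S))
          exact ⟨v, hv, by simpa using he⟩
        · obtain ⟨v, hv, he⟩ := exists_mem_eq_sup' h (fun v => gameVal G (!true) (insert v S))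
          exact ⟨v, hv, by simpa using he⟩
      have h₁ := card_insert_of_notMem (mem_playable.mp hv).1
      have h₂ := card_le_univ (insert v S)
      obtain ⟨T, hT, hT', hcard⟩ := ih (Fintype.card V - #(insert v S)) (by omega) (!turn)
        (by simpa using (mem_playable.mp hv).2) rfl
      exact ⟨T, (subset_insert v S).trans hT, hT', by rw [hcard, hval]⟩
    · exact ⟨S, Subset.rfl, isMaximalGPSet_of_playable_empty hS h,
        (gameVal_of_not_nonempty turn h).symm⟩

theorem mem_playable_empty (v : V) : v ∈ playable G ∅ :=
  mem_playable.mpr ⟨by simp, isGPSet_of_ncard_le_two G (Set.toFinite _) (by simp)⟩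

theorem mem_playable_singleton {a b : V} (h : b ≠ a) : b ∈ playable G {a} :=
  mem_playable.mpr ⟨by simpa using h, isGPSet_of_ncard_le_two G (Set.toFinite _)
    (by rw [coe_singleton, Set.ncard_pair h])⟩

theorem le_gpg [Nontrivial V] (a : V)
    (h : ∀ b ≠ a, ∃ c, c ≠ a ∧ c ≠ b ∧ IsGPSet G {a, b, c} ∧
      ∀ T : Finset V, IsMaximalGPSet G (T : Set V) → a ∈ T → c ∈ T → m ≤ #T) :
    m ≤ gpg G := by
  classical
  refine le_gameVal_true (mem_playable_empty a) ?_
  obtain ⟨b, hb⟩ := exists_ne a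
  simp only [insert_empty_eq]
  refine le_gameVal_false ⟨b, mem_playable_singleton hb⟩ fun b hb => ?_
  obtain ⟨c, hca, hcb, hc, hT⟩ := h b (by simpa using (mem_playable.mp hb).1)
  have hgp : IsGPSet G ((insert c (insert b {a}) : Finset V) : Set V) := by
    convert hc using 1; ext; simp; tauto
  refine le_gameVal_true (v := c)
    (mem_playable.mpr ⟨by simp [hca, hcb], by simpa using hgp⟩) ?_
  obtain ⟨T, hsub, hmax, hcard⟩ := exists_card_eq_gameVal false hgp
  exact (hT T hmax (hsub (by simp)) (hsub (by simp))).trans (le_of_eq (by convert hcard))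

theorem gpg_le [Nonempty V]
    (h : ∀ a, ∃ b ≠ a, ∀ T : Finset V, IsGPSet G T → b ∈ T → #T ≤ m) :
    gpg G ≤ m := by
  classical
  refine gameVal_true_le ⟨Classical.arbitrary V, mem_playable_empty _⟩ fun a _ => ?_
  obtain ⟨b, hb, hT⟩ := h a
  simp only [insert_empty_eq]
  refine gameVal_false_le (mem_playable_singleton hb) ?_
  obtain ⟨T, hsub, hmax, hcard⟩ := exists_card_eq_gameVal (G := G) (S := insert b {a}) true
    (by simpa using (mem_playable.mp (mem_playable_singleton hb)).2)
  exact (le_of_eq (by convert hcard.symm)).trans (hT T hmax.1 (hsub (by simp)))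

theorem le_gpg' [Nonempty V]
    (h : ∀ a, ∃ b ≠ a, ∀ T : Finset V, IsMaximalGPSet G (T : Set V) → b ∈ T → m ≤ #T) :
    m ≤ gpg' G := by
  classical
  refine le_gameVal_false ⟨Classical.arbitrary V, mem_playable_empty _⟩ fun a _ => ?_
  obtain ⟨b, hb, hT⟩ := h a
  simp only [insert_empty_eq]
  refine le_gameVal_true (mem_playable_singleton hb) ?_
  obtain ⟨T, hsub, hmax, hcard⟩ := exists_card_eq_gameVal (G := G) (S := insert b {a}) false
    (by simpa using (mem_playable.mp (mem_playable_singleton hb)).2)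
  exact (hT T hmax (hsub (by simp))).trans (le_of_eq (by convert hcard))

theorem gpg'_le [Nontrivial V] (a : V)
    (h : ∀ b ≠ a, ∃ c, c ≠ a ∧ c ≠ b ∧ IsGPSet G {a, b, c} ∧
      ∀ T : Finset V, IsGPSet G T → a ∈ T → c ∈ T → #T ≤ m) :
    gpg' G ≤ m := by
  classical
  refine gameVal_false_le (mem_playable_empty a) ?_
  obtain ⟨b, hb⟩ := exists_ne a
  simp only [insert_empty_eq]
  refine gameVal_true_le ⟨b, mem_playable_singleton hb⟩ fun b hb => ?_
  obtain ⟨c, hca, hcb, hc, hT⟩ := h b (by simpa using (mem_playable.mp hb).1)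
  have hgp : IsGPSet G ((insert c (insert b {a}) : Finset V) : Set V) := by
    convert hc using 1; ext; simp; tauto
  refine gameVal_false_le (v := c)
    (mem_playable.mpr ⟨by simp [hca, hcb], by simpa using hgp⟩) ?_
  obtain ⟨T, hsub, hmax, hcard⟩ := exists_card_eq_gameVal true hgp
  exact (le_of_eq (by convert hcard.symm)).trans (hT T hmax.1 (hsub (by simp)) (hsub (by simp)))

end Game

section Hjk

/-- The classes of mutually interchangeable vertices of `H(j,k)`. -/
inductive VertexClass
  | J₁ | J₂ | K₁ | K₂ | z | x₁ | x₂
  deriving DecidableEq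

namespace VertexClass

instance : Fintype VertexClass :=
  ⟨{J₁, J₂, K₁, K₂, z, x₁, x₂}, fun s => by cases s <;> decide⟩

/-- The distance in `H(j,k)` between distinct vertices of given classes. -/
def dist : VertexClass → VertexClass → ℕ
  | x₁, x₂ | x₂, x₁ => 3
  | z, K₁ | z, K₂ | z, x₁ | z, x₂ | K₁, z | K₂, z | x₁, z | x₂, z => 2
  | x₁, J₂ | x₁, K₂ | J₂, x₁ | K₂, x₁ => 2
  | x₂, J₁ | x₂, K₁ | J₁, x₂ | K₁, x₂ => 2
  | _, _ => 1

/-- No class of `A` lies between two others. -/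
def IsGP (A : Finset VertexClass) : Prop :=
  ∀ s ∈ A, ∀ t ∈ A, ∀ r ∈ A, dist s t + dist t r ≠ dist s r

instance : DecidablePred IsGP := fun A => by unfold IsGP; infer_instance

/-- The number of vertices in each class. -/
def size (j k : ℕ) : VertexClass → ℕ
  | J₁ | J₂ => j
  | K₁ | K₂ => k
  | _ => 1

end VertexClass

open VertexClass

/-- The class of a vertex of `H(j,k)`. -/
def vertexClass {j k : ℕ} : ((Fin j ⊕ Fin j) ⊕ (Fin k ⊕ Fin k)) ⊕ Fin 3 → VertexClass
  | Sum.inl (Sum.inl (Sum.inl _)) => J₁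
  | Sum.inl (Sum.inl (Sum.inr _)) => J₂
  | Sum.inl (Sum.inr (Sum.inl _)) => K₁
  | Sum.inl (Sum.inr (Sum.inr _)) => K₂
  | Sum.inr 0 => z
  | Sum.inr 1 => x₁
  | Sum.inr 2 => x₂

variable {j k : ℕ}

theorem exists_vertexClass_eq (hj : 1 ≤ j) (hk : 1 ≤ k) (s : VertexClass) :
    ∃ v : ((Fin j ⊕ Fin j) ⊕ (Fin k ⊕ Fin k)) ⊕ Fin 3, vertexClass v = s := by
  cases s
  · exact ⟨.inl (.inl (.inl ⟨0, hj⟩)), rfl⟩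
  · exact ⟨.inl (.inl (.inr ⟨0, hj⟩)), rfl⟩
  · exact ⟨.inl (.inr (.inl ⟨0, hk⟩)), rfl⟩
  · exact ⟨.inl (.inr (.inr ⟨0, hk⟩)), rfl⟩
  · exact ⟨.inr 0, rfl⟩
  · exact ⟨.inr 1, rfl⟩
  · exact ⟨.inr 2, rfl⟩

theorem card_vertexClass_eq (s : VertexClass) :
    #{v : ((Fin j ⊕ Fin j) ⊕ (Fin k ⊕ Fin k)) ⊕ Fin 3 | vertexClass v = s} = size j k s := by
  rw [card_filter]
  cases s <;> simp [Fintype.sum_sum_type, Fin.sum_univ_three, vertexClass, size]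

theorem Hjk_adj_iff (v w : ((Fin j ⊕ Fin j) ⊕ (Fin k ⊕ Fin k)) ⊕ Fin 3) :
    (Hjk j k).Adj v w ↔ v ≠ w ∧ (vertexClass v).dist (vertexClass w) = 1 := by
  rcases v with ((_ | _) | (_ | _)) | v <;> rcases w with ((_ | _) | (_ | _)) | w <;>
    try fin_cases v
  all_goals try fin_cases w
  all_goals simp [Hjk, HjkRel, inJPart, inSide1, inSide2, vertexClass, VertexClass.dist]

theorem exists_walk_length_eq (hj : 1 ≤ j) (hk : 1 ≤ k)
    {v w : ((Fin j ⊕ Fin j) ⊕ (Fin k ⊕ Fin k)) ⊕ Fin 3} (hvw : v ≠ w) :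
    ∃ p : (Hjk j k).Walk v w, p.length = (vertexClass v).dist (vertexClass w) := by
  have step : ∀ s t : VertexClass, s.dist t = 1 ∨
      ∃ r, s ≠ r ∧ r ≠ t ∧ r.dist t = 1 ∧ s.dist r + 1 = s.dist t := by decide
  induction hn : (vertexClass v).dist (vertexClass w) using Nat.strong_induction_on
    generalizing w with
  | _ n ih =>
    rcases step (vertexClass v) (vertexClass w) with h | ⟨r, hr, hr', hadj, hsum⟩
    · exact ⟨((Hjk_adj_iff v w).mpr ⟨hvw, h⟩).toWalk, by simp [← hn, h]⟩
    · obtain ⟨u, rfl⟩ := exists_vertexClass_eq hj hk r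
      obtain ⟨p, hp⟩ := ih _ (by omega) (w := u) (fun h => hr (congrArg _ h)) rfl
      exact ⟨p.concat ((Hjk_adj_iff u w).mpr ⟨fun h => hr' (congrArg _ h), hadj⟩),
        by rw [Walk.length_concat, hp]; omega⟩

theorem Hjk_connected (hj : 1 ≤ j) (hk : 1 ≤ k) : (Hjk j k).Connected where
  preconnected v w := by
    by_cases h : v = w
    · exact h ▸ Reachable.refl _
    · exact ⟨(exists_walk_length_eq hj hk h).choose⟩
  nonempty := ⟨.inr 0⟩

theorem classDist_le_walk_length (s : VertexClass)
    {v w : ((Fin j ⊕ Fin j) ⊕ (Fin k ⊕ Fin k)) ⊕ Fin 3} (p : (Hjk j k).Walk v w)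
    (hs : s ≠ vertexClass w) :
    s.dist (vertexClass w) ≤
      (if s = vertexClass v then 0 else s.dist (vertexClass v)) + p.length := by
  have step : ∀ s t r : VertexClass, t.dist r = 1 →
      (if s = r then 0 else s.dist r) ≤ (if s = t then 0 else s.dist t) + 1 := by decide
  induction p with
  | nil => simp [hs]
  | cons h p ih =>
    have h₁ := ih hs
    have h₂ := step s _ _ ((Hjk_adj_iff _ _).mp h).2
    rw [Walk.length_cons]
    omega

theorem Hjk_dist (hj : 1 ≤ j) (hk : 1 ≤ k)
    {v w : ((Fin j ⊕ Fin j) ⊕ (Fin k ⊕ Fin k)) ⊕ Fin 3} (hvw : v ≠ w) :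
    (Hjk j k).dist v w = (vertexClass v).dist (vertexClass w) := by
  apply le_antisymm
  · obtain ⟨p, hp⟩ := exists_walk_length_eq hj hk hvw
    exact hp ▸ dist_le p
  · by_cases h : vertexClass v = vertexClass w
    · have hself : ∀ s : VertexClass, s.dist s = 1 := by decide
      rw [h, hself]
      exact (Hjk_connected hj hk).pos_dist_of_ne hvw
    · obtain ⟨p, hp⟩ := (Hjk_connected hj hk).exists_walk_length_eq_dist v w
      simpa [hp] using classDist_le_walk_length (vertexClass v) p h

theorem Hjk_isGPSet_iff (hj : 1 ≤ j) (hk : 1 ≤ k)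
    (S : Set (((Fin j ⊕ Fin j) ⊕ (Fin k ⊕ Fin k)) ⊕ Fin 3)) :
    IsGPSet (Hjk j k) S ↔ ∀ a ∈ S, ∀ b ∈ S, ∀ c ∈ S,
      (vertexClass a).dist (vertexClass b) + (vertexClass b).dist (vertexClass c)
        ≠ (vertexClass a).dist (vertexClass c) := by
  have hne : ∀ s t r : VertexClass, s.dist t + t.dist r = s.dist r →
      s ≠ t ∧ s ≠ r ∧ t ≠ r := by decide
  rw [isGPSet_iff_dist (Hjk_connected hj hk)]
  constructor
  · intro h a ha b hb c hc hd
    obtain ⟨h₁, h₂, h₃⟩ := hne _ _ _ hd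
    replace h₁ := ne_of_apply_ne _ h₁
    replace h₂ := ne_of_apply_ne _ h₂
    replace h₃ := ne_of_apply_ne _ h₃
    refine h a ha b hb c hc h₁ h₂ h₃ ?_
    rwa [Hjk_dist hj hk h₁, Hjk_dist hj hk h₂, Hjk_dist hj hk h₃]
  · intro h a ha b hb c hc h₁ h₂ h₃
    rw [Hjk_dist hj hk h₁, Hjk_dist hj hk h₂, Hjk_dist hj hk h₃]
    exact h a ha b hb c hc

theorem Hjk_isGPSet_iff_image (hj : 1 ≤ j) (hk : 1 ≤ k)
    (T : Finset (((Fin j ⊕ Fin j) ⊕ (Fin k ⊕ Fin k)) ⊕ Fin 3)) :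
    IsGPSet (Hjk j k) (T : Set _) ↔ IsGP (T.image vertexClass) := by
  simp only [Hjk_isGPSet_iff hj hk, IsGP, forall_mem_image, mem_coe]

theorem Hjk_isGPSet_triple (hj : 1 ≤ j) (hk : 1 ≤ k) {s t r : VertexClass}
    {a b c : ((Fin j ⊕ Fin j) ⊕ (Fin k ⊕ Fin k)) ⊕ Fin 3} (ha : vertexClass a = s)
    (hb : vertexClass b = t) (hc : vertexClass c = r) (h : IsGP {s, t, r}) :
    IsGPSet (Hjk j k) {a, b, c} := by
  subst ha hb hc
  simpa using (Hjk_isGPSet_iff_image hj hk {a, b, c}).mpr (by simpa using h)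

theorem card_le_of_image_subset {T : Finset (((Fin j ⊕ Fin j) ⊕ (Fin k ⊕ Fin k)) ⊕ Fin 3)}
    {A : Finset VertexClass} (h : T.image vertexClass ⊆ A) : #T ≤ ∑ s ∈ A, size j k s := by
  rw [card_eq_sum_card_fiberwise (f := vertexClass) (t := A)
    (fun v hv => h (mem_image_of_mem _ hv))]
  refine sum_le_sum fun s _ => ?_
  rw [← card_vertexClass_eq s]
  exact card_le_card (filter_subset_filter _ (subset_univ T))

/-- A maximal general position set is a union of classes. -/
theorem exists_card_eq_of_isMaximalGPSet (hj : 1 ≤ j) (hk : 1 ≤ k)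
    {T : Finset (((Fin j ⊕ Fin j) ⊕ (Fin k ⊕ Fin k)) ⊕ Fin 3)}
    (hT : IsMaximalGPSet (Hjk j k) (T : Set _)) :
    IsGP (T.image vertexClass) ∧
      (∀ s ∉ T.image vertexClass, ¬ IsGP (insert s (T.image vertexClass))) ∧
      #T = ∑ s ∈ T.image vertexClass, size j k s := by
  have hins : ∀ v ∉ T, ¬ IsGP (insert (vertexClass v) (T.image vertexClass)) := by
    intro v hv h
    refine hT.2 v hv ?_
    rwa [← image_insert, ← Hjk_isGPSet_iff_image hj hk, coe_insert] at h
  have hgp := (Hjk_isGPSet_iff_image hj hk T).mp hT.1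
  refine ⟨hgp, fun s hs h => ?_, ?_⟩
  · obtain ⟨v, rfl⟩ := exists_vertexClass_eq hj hk s
    exact hins v (fun hv => hs (mem_image_of_mem _ hv)) h
  · rw [card_eq_sum_card_image vertexClass T]
    refine sum_congr rfl fun s hs => ?_
    rw [← card_vertexClass_eq s]
    congr 1
    ext v
    simp only [mem_filter, mem_univ, true_and, and_iff_right_iff_imp]
    rintro rfl
    by_contra hv
    exact hins v hv (by rwa [insert_eq_of_mem hs])

theorem VertexClass.maximal_of_J (A : Finset VertexClass) (hA : IsGP A)
    (hmax : ∀ s ∉ A, ¬ IsGP (insert s A)) (hJ : J₁ ∈ A ∨ J₂ ∈ A) :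
    A = {J₁, J₂, K₁, K₂} ∨ A = {z, J₁, J₂} ∨
      A = {x₁, J₁, K₁} ∨ A = {x₂, J₁, K₁} ∨ A = {z, x₂, J₁} ∨
      A = {x₁, J₂, K₂} ∨ A = {x₂, J₂, K₂} ∨ A = {z, x₁, J₂} := by
  revert A
  decide +kernel

theorem VertexClass.subset_of_x (A : Finset VertexClass) (hA : IsGP A)
    (hx : x₁ ∈ A ∨ x₂ ∈ A) :
    (z ∉ A ∧ (A ⊆ {x₁, J₁, K₁} ∨ A ⊆ {x₁, J₂, K₂} ∨ A ⊆ {x₂, J₁, K₁} ∨ A ⊆ {x₂, J₂, K₂} ∨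
        A ⊆ {x₁, x₂})) ∨
      A ⊆ {z, x₁, J₂} ∨ A ⊆ {z, x₂, J₁} ∨ A ⊆ {z, x₁, K₁} ∨ A ⊆ {z, x₁, K₂} ∨
      A ⊆ {z, x₂, K₁} ∨ A ⊆ {z, x₂, K₂} ∨ A ⊆ {z, x₁, x₂} := by
  revert A
  decide +kernel

theorem card_ge_of_J_mem (hk : 1 ≤ k) (hkj : k ≤ j)
    {T : Finset (((Fin j ⊕ Fin j) ⊕ (Fin k ⊕ Fin k)) ⊕ Fin 3)}
    (hT : IsMaximalGPSet (Hjk j k) (T : Set _))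
    (hJ : J₁ ∈ T.image vertexClass ∨ J₂ ∈ T.image vertexClass) : j + 2 ≤ #T := by
  obtain ⟨hA, hmax, hcard⟩ := exists_card_eq_of_isMaximalGPSet (hk.trans hkj) hk hT
  rw [hcard]
  rcases maximal_of_J _ hA hmax hJ with h | h | h | h | h | h | h | h <;> rw [h] <;>
    simp [size] <;> omega

theorem card_ge_of_J₁_mem (hk : 1 ≤ k) (hkj : k ≤ j)
    {T : Finset (((Fin j ⊕ Fin j) ⊕ (Fin k ⊕ Fin k)) ⊕ Fin 3)}
    (hT : IsMaximalGPSet (Hjk j k) (T : Set _)) (hJ : J₁ ∈ T.image vertexClass)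
    (hJK : J₂ ∈ T.image vertexClass ∨ K₁ ∈ T.image vertexClass) : j + k + 1 ≤ #T := by
  obtain ⟨hA, hmax, hcard⟩ := exists_card_eq_of_isMaximalGPSet (hk.trans hkj) hk hT
  rw [hcard]
  rcases maximal_of_J _ hA hmax (Or.inl hJ) with h | h | h | h | h | h | h | h <;>
    rw [h] at hJ hJK ⊢ <;> simp [size] at hJ hJK ⊢ <;> omega

theorem card_le_of_x_mem (hk : 1 ≤ k) (hkj : k ≤ j)
    {T : Finset (((Fin j ⊕ Fin j) ⊕ (Fin k ⊕ Fin k)) ⊕ Fin 3)}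
    (hT : IsGPSet (Hjk j k) (T : Set _))
    (hx : x₁ ∈ T.image vertexClass ∨ x₂ ∈ T.image vertexClass) : #T ≤ j + k + 1 := by
  rw [Hjk_isGPSet_iff_image (hk.trans hkj) hk] at hT
  rcases subset_of_x _ hT hx with ⟨-, h | h | h | h | h⟩ | h | h | h | h | h | h | h <;>
    refine (card_le_of_image_subset h).trans ?_ <;> simp [size] <;> omega

theorem card_le_of_z_mem_of_x_mem (hk : 1 ≤ k) (hkj : k ≤ j)
    {T : Finset (((Fin j ⊕ Fin j) ⊕ (Fin k ⊕ Fin k)) ⊕ Fin 3)}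
    (hT : IsGPSet (Hjk j k) (T : Set _)) (hz : z ∈ T.image vertexClass)
    (hx : x₁ ∈ T.image vertexClass ∨ x₂ ∈ T.image vertexClass) : #T ≤ j + 2 := by
  rw [Hjk_isGPSet_iff_image (hk.trans hkj) hk] at hT
  rcases subset_of_x _ hT hx with ⟨h, -⟩ | h | h | h | h | h | h | h
  · exact absurd hz h
  all_goals
    refine (card_le_of_image_subset h).trans ?_
    simp [size]
    omega

theorem gpg_Hjk (hk : 1 ≤ k) (hkj : k ≤ j) : gpg (Hjk j k) = j + k + 1 := by
  have hj := hk.trans hkj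
  have hmem := fun (T : Finset (((Fin j ⊕ Fin j) ⊕ (Fin k ⊕ Fin k)) ⊕ Fin 3)) v (hv : v ∈ T) =>
    mem_image_of_mem vertexClass hv
  apply le_antisymm
  · refine gpg_le fun a => ?_
    by_cases ha : a = .inr 1
    · exact ⟨.inr 2, by simp [ha], fun T hT hb => card_le_of_x_mem hk hkj hT (.inr (hmem T _ hb))⟩
    · exact ⟨.inr 1, Ne.symm ha, fun T hT hb => card_le_of_x_mem hk hkj hT (.inl (hmem T _ hb))⟩
  · have : Nontrivial (((Fin j ⊕ Fin j) ⊕ (Fin k ⊕ Fin k)) ⊕ Fin 3) :=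
      Sum.inr_injective.nontrivial
    refine le_gpg (.inl (.inl (.inl ⟨0, hj⟩))) fun b hb => ?_
    by_cases hcase : vertexClass b = x₁ ∨ vertexClass b = x₂ ∨ vertexClass b = J₂
    · refine ⟨.inl (.inr (.inl ⟨0, hk⟩)), by simp, ?_, ?_, fun T hT ha hc =>
        card_ge_of_J₁_mem hk hkj hT (hmem T _ ha) (.inr (hmem T _ hc))⟩
      · rintro rfl
        simp [vertexClass] at hcase
      · rcases hcase with h | h | h <;>
          exact Hjk_isGPSet_triple (s := J₁) (r := K₁) hj hk rfl h rfl (by decide)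
    · refine ⟨.inl (.inl (.inr ⟨0, hj⟩)), by simp, ?_, ?_, fun T hT ha hc =>
        card_ge_of_J₁_mem hk hkj hT (hmem T _ ha) (.inl (hmem T _ hc))⟩
      · rintro rfl
        simp [vertexClass] at hcase
      · cases h : vertexClass b <;>
          first
          | exact Hjk_isGPSet_triple (s := J₁) (r := J₂) hj hk rfl h rfl (by decide)
          | simp [h] at hcase

theorem gpg'_Hjk (hk : 1 ≤ k) (hkj : k ≤ j) : gpg' (Hjk j k) = j + 2 := by
  have hj := hk.trans hkj
  have hmem := fun (T : Finset (((Fin j ⊕ Fin j) ⊕ (Fin k ⊕ Fin k)) ⊕ Fin 3)) v (hv : v ∈ T) =>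
    mem_image_of_mem vertexClass hv
  apply le_antisymm
  · have : Nontrivial (((Fin j ⊕ Fin j) ⊕ (Fin k ⊕ Fin k)) ⊕ Fin 3) :=
      Sum.inr_injective.nontrivial
    refine gpg'_le (.inr 0) fun b hb => ?_
    by_cases hcase : vertexClass b = x₁ ∨ vertexClass b = J₁
    · refine ⟨.inr 2, by simp, ?_, ?_, fun T hT ha hc =>
        card_le_of_z_mem_of_x_mem hk hkj hT (hmem T _ ha) (.inr (hmem T _ hc))⟩
      · rintro rfl
        simp [vertexClass] at hcase
      · rcases hcase with h | h <;>
          exact Hjk_isGPSet_triple (s := z) (r := x₂) hj hk rfl h rfl (by decide)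
    · refine ⟨.inr 1, by simp, ?_, ?_, fun T hT ha hc =>
        card_le_of_z_mem_of_x_mem hk hkj hT (hmem T _ ha) (.inl (hmem T _ hc))⟩
      · rintro rfl
        simp [vertexClass] at hcase
      · cases h : vertexClass b <;>
          first
          | exact Hjk_isGPSet_triple (s := z) (r := x₁) hj hk rfl h rfl (by decide)
          | simp [h] at hcase
  · refine le_gpg' fun a => ?_
    by_cases ha : a = .inl (.inl (.inl ⟨0, hj⟩))
    · exact ⟨.inl (.inl (.inr ⟨0, hj⟩)), by simp [ha], fun T hT hb =>
        card_ge_of_J_mem hk hkj hT (.inr (hmem T _ hb))⟩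
    · exact ⟨.inl (.inl (.inl ⟨0, hj⟩)), Ne.symm ha, fun T hT hb =>
        card_ge_of_J_mem hk hkj hT (.inl (hmem T _ hb))⟩

end Hjk

/-- For `j ≥ k ≥ 1`, `gpg(H(j,k)) = j + k + 1` and `gpg'(H(j,k)) = j + 2`;
in particular the pair `(j + k + 1, j + 2)` is realisable. -/
theorem stmt_15 (j k : ℕ) (hk : 1 ≤ k) (hkj : k ≤ j) :
    (gpg (Hjk j k) = j + k + 1 ∧ gpg' (Hjk j k) = j + 2) ∧
    ∃ (V : Type) (_ : Fintype V) (G : SimpleGraph V),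
      gpg G = j + k + 1 ∧ gpg' G = j + 2 := by
  exact ⟨⟨gpg_Hjk hk hkj, gpg'_Hjk hk hkj⟩, _, inferInstance, Hjk j k, gpg_Hjk hk hkj,
    gpg'_Hjk hk hkj⟩
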